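/- Let A be a ring with a two-sided idempotent ideal J such that J is projective as a left A-module, and let M, N be left A/J-modules. Then Ext^i_A(M, N) ≅ Ext^i_{A/J}(M, N) for all i ≥ 0. -/

import Mathlib

open CategoryTheory

universe u

section

universe w w' v v' u₁ u₂

open Abelian Limits

namespace CategoryTheory

namespace ProjectiveResolution

variable {C : Type u₁} [Category.{v} C] [Abelian C] [HasExt.{w} C] {X Y : C}
  (R : ProjectiveResolution X)

lemma extMk_eq_zero_iff_exists_up_prev {n : ℕ} (f : R.complex.X n ⟶ Y)
    (hf : R.complex.d (n + 1) n ≫ f = 0) :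
    R.extMk f (n + 1) rfl hf = 0 ↔
      ∃ g : R.complex.X ((ComplexShape.up ℕ).prev n) ⟶ Y,
        R.complex.d n ((ComplexShape.up ℕ).prev n) ≫ g = f := by
  cases n with
  | succ n =>
    have h : (ComplexShape.up ℕ).prev (n + 1) = n := (ComplexShape.up ℕ).prev_eq' rfl
    rw [h]
    exact R.extMk_eq_zero_iff f _ rfl hf n rfl
  | zero =>
    have h : (ComplexShape.up ℕ).prev 0 = 0 := by simp
    rw [h]
    simp only [← R.extEquivCohomologyClass.apply_eq_iff_eq, extEquivCohomologyClass_extMk,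
      extEquivCohomologyClass_zero, CochainComplex.HomComplex.CohomologyClass.mk_eq_zero_iff]
    rw [CochainComplex.HomComplex.Cocycle.toSingleMk_mem_coboundaries_iff _ _ _ _ _ 1 (by simp)]
    have h1 : IsZero (R.cochainComplex.X 1) :=
      CochainComplex.isZero_of_isStrictlyLE _ 0 _
    constructor
    · rintro ⟨g, hg⟩
      obtain rfl : g = 0 := h1.eq_of_src _ _
      refine ⟨0, ?_⟩
      rw [← cancel_epi (R.cochainComplexXIso (-(0 : ℕ)) 0 rfl).hom, ← hg]
      simp
    · rintro ⟨g, rfl⟩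
      exact ⟨0, by simp⟩

/-- The class in `Ext` of a cocycle with values in `Y`, as a homomorphism. -/
noncomputable def extMkHom (k : Type*) [Ring k] [Linear k C] (n : ℕ) :
    LinearMap.ker ((R.complex.linearYonedaObj k Y).sc' ((ComplexShape.up ℕ).prev n) n (n + 1)).g.hom
      →+ Abelian.Ext X Y n where
  toFun f := R.extMk f.1 (n + 1) rfl f.2
  map_zero' := R.extMk_zero _ rfl
  map_add' f g := (R.add_extMk f.1 g.1 _ rfl f.2 g.2).symm

/-- The `Ext`-groups defined through left derived functors are isomorphic to those defined through
the derived category. -/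
lemma nonempty_ext_addEquiv [EnoughProjectives C] (k : Type*) [Ring k] [Linear k C] {X : C}
    (R : ProjectiveResolution X) (Y : C) (n : ℕ) :
    Nonempty (((_root_.Ext k C n).obj (Opposite.op X)).obj Y ≃+ Abelian.Ext X Y n) := by
  let K := R.complex.linearYonedaObj k Y
  let S := K.sc' ((ComplexShape.up ℕ).prev n) n (n + 1)
  let e : ((_root_.Ext k C n).obj (Opposite.op X)).obj Y ≅ S.moduleCatLeftHomologyData.H :=
    R.isoExt n Y ≪≫ ShortComplex.homologyMapIso
      (K.isoSc' _ n (n + 1) rfl ((ComplexShape.up ℕ).next_eq' rfl)) ≪≫ S.moduleCatHomologyIso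
  have hker : (LinearMap.range S.moduleCatToCycles).toAddSubgroup =
      (R.extMkHom (Y := Y) k n).ker := by
    ext f
    constructor
    · rintro ⟨g, hg⟩
      exact (R.extMk_eq_zero_iff_exists_up_prev f.1 f.2).2 ⟨g, congr_arg Subtype.val hg⟩
    · intro h
      obtain ⟨g, hg⟩ := (R.extMk_eq_zero_iff_exists_up_prev f.1 f.2).1 h
      exact ⟨g, Subtype.ext hg⟩
  have hsurj : Function.Surjective (R.extMkHom (Y := Y) k n) := fun x ↦ by
    obtain ⟨f, hf, rfl⟩ := R.extMk_surjective x (n + 1) rfl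
    exact ⟨⟨f, hf⟩, rfl⟩
  exact ⟨e.toLinearEquiv.toAddEquiv.trans ((QuotientAddGroup.quotientAddEquivOfEq hker).trans
    (QuotientAddGroup.quotientKerEquivOfSurjective _ hsurj))⟩

end ProjectiveResolution

end CategoryTheory

variable {C : Type u₁} [Category.{v} C] [Abelian C] {D : Type u₂} [Category.{v'} D] [Abelian D]

/-- A fully faithful exact functor which sends enough projective objects to objects that are
left acyclic with respect to its image induces bijections on all `Ext`-groups. -/
lemma CategoryTheory.Functor.mapExt_bijective_of_projectivePresentation
    [HasExt.{w} C] [HasExt.{w'} D] (F : C ⥤ D) [F.Additive]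
    [PreservesFiniteLimits F] [PreservesFiniteColimits F] [F.Full] [F.Faithful] (Y : C)
    (hF : ∀ X : C, ∃ P : ProjectivePresentation X, ∀ n : ℕ,
      Subsingleton (Abelian.Ext.{w'} (F.obj P.p) (F.obj Y) (n + 1))) (X : C) (n : ℕ) :
    Function.Bijective (F.mapExtAddHom X Y n) := by
  induction n generalizing X with
  | zero =>
    simpa [Ext.mapExactFunctor₀] using ⟨Faithful.map_injective, Full.map_surjective⟩
  | succ n hn =>
    obtain ⟨P, hP⟩ := hF X
    let S := ShortComplex.mk _ _ (kernel.condition P.f)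
    have : Subsingleton (Abelian.Ext.{w'} (S.map F).X₂ (F.obj Y) (n + 1)) := hP n
    have : Projective S.X₂ := P.projective
    have hS : S.ShortExact := { exact := ShortComplex.exact_kernel P.f }
    have := Ext.subsingleton_of_projective.{w} S.X₂ Y n
    exact AddMonoidHom.bijective_of_surjective_of_bijective_of_right_exact _ _ _ _
      (F.mapExtAddHom S.X₂ Y n) (F.mapExtAddHom S.X₁ Y n) (F.mapExtAddHom S.X₃ Y (n + 1))
      (by ext; simp [Ext.mapExactFunctor_comp, Ext.mapExactFunctor_mk₀]; rfl)
      (by ext; simp [Ext.mapExactFunctor_comp, Ext.mapExactFunctor_extClass]; rfl)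
      ((ShortComplex.ab_exact_iff_function_exact _).1
        (Ext.contravariant_sequence_exact₁' hS Y n (n + 1) (add_comm 1 n)))
      ((ShortComplex.ab_exact_iff_function_exact _).1
        (Ext.contravariant_sequence_exact₁' (hS.map F) (F.obj Y) n (n + 1) (add_comm 1 n)))
      (hn _).surjective (hn _)
      (fun x₃ ↦ Ext.contravariant_sequence_exact₃ hS _ x₃ (by subsingleton) (add_comm 1 n))
      (fun y₃ ↦ Ext.contravariant_sequence_exact₃ (hS.map F) _ y₃
        (Subsingleton.elim _ _) (add_comm 1 n))

/-- If `0 → P₁ → P₀ → X → 0` is exact with `P₁`, `P₀` projective and every morphism `P₁ ⟶ Y`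
vanishes, then all positive degree `Ext`-groups from `X` to `Y` vanish. -/
lemma CategoryTheory.ShortComplex.ShortExact.subsingleton_ext_of_projective [HasExt.{w} C]
    {S : ShortComplex C} (hS : S.ShortExact) [Projective S.X₁] [Projective S.X₂] {Y : C}
    (hY : ∀ f : S.X₁ ⟶ Y, f = 0) (n : ℕ) : Subsingleton (Abelian.Ext.{w} S.X₃ Y (n + 1)) := by
  have := Ext.subsingleton_of_projective.{w} S.X₂ Y n
  refine subsingleton_of_forall_eq 0 fun x ↦ ?_
  obtain ⟨y, rfl⟩ := Ext.contravariant_sequence_exact₃ hS _ x (Subsingleton.elim _ _) (add_comm 1 n)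
  have hy : y = 0 := by
    cases n with
    | zero => rw [← Ext.mk₀_addEquiv₀_apply y, hY (Ext.addEquiv₀ y), Ext.mk₀_zero]
    | succ n => exact Ext.eq_zero_of_projective y
  simp [hy]

end

section

variable {A B : Type u} [Ring A] [Ring B] (f : A →+* B)

lemma ModuleCat.restrictScalars_preservesFiniteLimits_and_colimits :
    Limits.PreservesFiniteLimits (ModuleCat.restrictScalars.{u} f) ∧
      Limits.PreservesFiniteColimits (ModuleCat.restrictScalars.{u} f) :=
  ((Functor.exact_tfae (ModuleCat.restrictScalars.{u} f)).out 1 3).mp fun S h ↦ by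
    rw [ShortComplex.ShortExact.moduleCat_exact_iff_function_exact] at h ⊢
    exact h

lemma ModuleCat.restrictScalars_full_of_surjective (hf : Function.Surjective f) :
    (ModuleCat.restrictScalars.{u} f).Full where
  map_surjective {M N} g := by
    refine ⟨ModuleCat.ofHom
      { toFun := g, map_add' := fun x y ↦ g.hom.map_add x y, map_smul' := fun b x ↦ ?_ }, rfl⟩
    obtain ⟨a, rfl⟩ := hf b
    exact g.hom.map_smul a x

/-- The presentation of a module by the free module on its underlying set. -/
noncomputable def ModuleCat.freePresentation (X : ModuleCat.{u} B) : ProjectivePresentation X where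
  p := ModuleCat.of B (X →₀ B)
  projective := ModuleCat.projective_of_free (Module.Free.chooseBasis B (X →₀ B))
  f := ModuleCat.ofHom (Finsupp.linearCombination B id)
  epi := (ModuleCat.epi_iff_surjective _).2 (Finsupp.linearCombination_id_surjective B X)

lemma Ideal.linearMap_eq_zero_of_span_mul_eq_self {I : Ideal A}
    (hI : Submodule.span A {z : A | ∃ u ∈ I, ∃ v ∈ I, z = u * v} = I)
    {N : Type*} [AddCommGroup N] [Module A N] (hN : ∀ a ∈ I, ∀ x : N, a • x = 0)
    (φ : I →ₗ[A] N) : φ = 0 := by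
  have h : I ≤ (LinearMap.ker φ).map I.subtype := by
    conv_lhs => rw [← hI]
    rw [Submodule.span_le]
    rintro _ ⟨u, hu, v, hv, rfl⟩
    exact ⟨u • ⟨v, hv⟩, by rw [SetLike.mem_coe, LinearMap.mem_ker, map_smul, hN u hu], rfl⟩
  ext ⟨z, hz⟩
  obtain ⟨y, hy, rfl⟩ := h hz
  exact hy

lemma ModuleCat.subsingleton_ext_restrictScalars_finsupp (hf : Function.Surjective f)
    (hI : Submodule.span A {z : A | ∃ u ∈ RingHom.ker f, ∃ v ∈ RingHom.ker f, z = u * v} =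
      RingHom.ker f)
    (hproj : Module.Projective A (RingHom.ker f)) (ι : Type u) (N : ModuleCat.{u} B) (n : ℕ) :
    Subsingleton (Abelian.Ext.{u}
      ((ModuleCat.restrictScalars.{u} f).obj (ModuleCat.of B (ι →₀ B)))
      ((ModuleCat.restrictScalars.{u} f).obj N) (n + 1)) := by
  let : Module A B := Module.compHom B f
  let p : A →ₗ[A] B :=
    { toFun := f, map_add' := f.map_add, map_smul' := fun a b ↦ f.map_mul a b }
  let i : RingHom.ker f →ₗ[A] A := (RingHom.ker f).subtype
  have hip : LinearMap.range i = LinearMap.ker p := (RingHom.ker f).range_subtype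
  have hi : LinearMap.ker i = ⊥ := (RingHom.ker f).ker_subtype
  have hexact : LinearMap.range (Finsupp.mapRange.linearMap (α := ι) i) =
      LinearMap.ker (Finsupp.mapRange.linearMap (α := ι) p) := by
    rw [Finsupp.range_mapRange_linearMap _ hi, Finsupp.ker_mapRange, hip]
  let S : ShortComplex (ModuleCat.{u} A) := ShortComplex.mk
    (X₃ := (ModuleCat.restrictScalars.{u} f).obj (ModuleCat.of B (ι →₀ B)))
    (ModuleCat.ofHom (Finsupp.mapRange.linearMap (α := ι) i))
    (ModuleCat.ofHom (Finsupp.mapRange.linearMap (α := ι) p))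
    (ModuleCat.hom_ext (LinearMap.range_le_ker_iff.1 hexact.le))
  have hS : S.ShortExact := ModuleCat.shortComplex_shortExact S
    (LinearMap.exact_iff.2 hexact.symm)
    (Finsupp.mapRange_injective _ i.map_zero Subtype.val_injective)
    (Finsupp.mapRange_surjective _ p.map_zero hf)
  have : Projective S.X₁ :=
    (IsProjective.iff_projective (ι →₀ RingHom.ker f)).1 <| by
      classical exact .of_equiv (finsuppLequivDFinsupp A).symm
  have : Projective S.X₂ := (IsProjective.iff_projective (ι →₀ A)).1 inferInstance
  refine hS.subsingleton_ext_of_projective (fun φ ↦ ModuleCat.hom_ext ?_) n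
  refine Finsupp.lhom_ext' fun a ↦ Ideal.linearMap_eq_zero_of_span_mul_eq_self hI ?_ _
  intro b hb (x : N)
  change f b • x = 0
  rw [hb, zero_smul]

lemma ModuleCat.mapExt_restrictScalars_bijective
    [Limits.PreservesFiniteLimits (ModuleCat.restrictScalars.{u} f)]
    [Limits.PreservesFiniteColimits (ModuleCat.restrictScalars.{u} f)] (hf : Function.Surjective f)
    (hI : Submodule.span A {z : A | ∃ u ∈ RingHom.ker f, ∃ v ∈ RingHom.ker f, z = u * v} =
      RingHom.ker f)
    (hproj : Module.Projective A (RingHom.ker f)) (M N : ModuleCat.{u} B) (n : ℕ) :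
    Function.Bijective ((ModuleCat.restrictScalars.{u} f).mapExtAddHom M N n) :=
  have := ModuleCat.restrictScalars_full_of_surjective f hf
  Functor.mapExt_bijective_of_projectivePresentation _ N (fun X ↦ ⟨X.freePresentation,
    ModuleCat.subsingleton_ext_restrictScalars_finsupp f hf hI hproj X N⟩) M n

end

/-- Let `A` be a ring with a two-sided idempotent ideal `J` (`J² = J`) which is
projective as a left `A`-module, and let `M`, `N` be left `A/J`-modules (viewed as
`A`-modules via the quotient map `A → A/J`).  Then `Ext^i_A(M, N) ≅ Ext^i_{A/J}(M, N)`
for all `i ≥ 0`. -/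
theorem ext_iso_of_idempotent_projective_ideal
    (A : Type u) [Ring A] (J : TwoSidedIdeal A)
    (hJ2 : Submodule.span A {z : A | ∃ u ∈ J, ∃ v ∈ J, z = u * v} = TwoSidedIdeal.asIdeal J)
    (hproj : Module.Projective A (TwoSidedIdeal.asIdeal J : Ideal A))
    (M N : Type u)
    [AddCommGroup M] [Module J.ringCon.Quotient M]
    [AddCommGroup N] [Module J.ringCon.Quotient N]
    (i : ℕ) :
    letI : Module A M := Module.compHom M (RingCon.mk' J.ringCon)
    letI : Module A N := Module.compHom N (RingCon.mk' J.ringCon)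
    Nonempty
      ((((Ext ℤ (ModuleCat.{u} A) i).obj (Opposite.op (ModuleCat.of A M))).obj
          (ModuleCat.of A N)) ≃+
        (((Ext ℤ (ModuleCat.{u} J.ringCon.Quotient) i).obj
            (Opposite.op (ModuleCat.of J.ringCon.Quotient M))).obj
          (ModuleCat.of J.ringCon.Quotient N))) := by
  have hf : Function.Surjective (RingCon.mk' J.ringCon) := RingCon.mk'_surjective _
  have hker : RingHom.ker (RingCon.mk' J.ringCon) = TwoSidedIdeal.asIdeal J := by
    ext x
    rw [TwoSidedIdeal.mem_asIdeal, RingHom.mem_ker, ← TwoSidedIdeal.mem_ker,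
      TwoSidedIdeal.ker_ringCon_mk']
  obtain ⟨_, _⟩ :=
    ModuleCat.restrictScalars_preservesFiniteLimits_and_colimits (RingCon.mk' J.ringCon)
  have hbij := ModuleCat.mapExt_restrictScalars_bijective (RingCon.mk' J.ringCon) hf
    (by rw [hker]; exact hJ2) (by rw [hker]; exact hproj) (ModuleCat.of _ M) (ModuleCat.of _ N) i
  obtain ⟨e₁⟩ := ProjectiveResolution.nonempty_ext_addEquiv ℤ
    (.of ((ModuleCat.restrictScalars (RingCon.mk' J.ringCon)).obj (ModuleCat.of _ M)))
    ((ModuleCat.restrictScalars (RingCon.mk' J.ringCon)).obj (ModuleCat.of _ N)) i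
  obtain ⟨e₂⟩ := ProjectiveResolution.nonempty_ext_addEquiv ℤ
    (.of (ModuleCat.of J.ringCon.Quotient M))
    (ModuleCat.of J.ringCon.Quotient N) i
  exact ⟨e₁.trans ((AddEquiv.ofBijective _ hbij).symm.trans e₂.symm)⟩
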